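/- arXiv:2102.09015 — 3 statements merged into one kernel-verified Lean document; each statement's English description precedes it below -/
import Mathlib

section
/- Let R = ⊕_{n≥0} R_n be a standard graded Noetherian ring, M a finitely generated graded R-module, a a homogeneous ideal, and suppose f := f_a^{R_+}(M) = 0, i.e., R_+ is not contained in the radical of the annihilator of Γ_a(M). Then if (R_0, m_0) is local, the a-torsion submodule Γ_a(M) satisfies Γ_a(M)_n ≠ 0 for all sufficiently large n; in particular Γ_a(M) is tame. -/
/-- The submodule `N :_M c = { m ∈ M | c • m ⊆ N }`. -/
def smulColon {A : Type} [CommRing A] {M : Type} [AddCommGroup M] [Module A M]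
    (N : Submodule A M) (c : Ideal A) : Submodule A M :=
  ⨅ r ∈ c, N.comap (DistribMulAction.toLinearMap A M r)

/-- The `a`-torsion submodule `Γ_a(M) = { m ∈ M | aᵏ m = 0 for some k }`. -/
def torsionSubmodule {A : Type} [CommRing A] (a : Ideal A) (M : Type) [AddCommGroup M]
    [Module A M] : Submodule A M :=
  ⨆ k : ℕ, smulColon (⊥ : Submodule A M) (a ^ k)

section GradedAux

open DirectSum

variable {R₀ A : Type} [CommRing R₀] [CommRing A] [Algebra R₀ A]
  {𝒜 : ℕ → Submodule R₀ A}
  {M : Type} [AddCommGroup M] [Module A M]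
  {ℳ : ℤ → AddSubgroup M} [DirectSum.Decomposition ℳ]

theorem decompose_smul_add
    (hsmul : ∀ (i : ℕ) (j : ℤ), ∀ a ∈ 𝒜 i, ∀ m ∈ ℳ j, a • m ∈ ℳ ((i : ℤ) + j))
    {i : ℕ} {r : A} (hr : r ∈ 𝒜 i) (m : M) (j : ℤ) :
    (decompose ℳ (r • m) ((i : ℤ) + j) : M) = r • (decompose ℳ m j : M) := by
  induction m using DirectSum.Decomposition.inductionOn ℳ with
  | zero => simp
  | @homogeneous l m =>
    by_cases h : l = j
    · subst h
      rw [decompose_of_mem_same ℳ (hsmul i l r hr m m.2), decompose_of_mem_same ℳ m.2]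
    · rw [decompose_of_mem_ne ℳ (hsmul i l r hr m m.2) (by lia), decompose_of_mem_ne ℳ m.2 h,
        smul_zero]
  | add m m' h h' =>
    simp only [smul_add, decompose_add, DirectSum.add_apply, AddSubgroup.coe_add, h, h']

theorem decompose_mem_smulColon_bot [GradedAlgebra 𝒜]
    (hsmul : ∀ (i : ℕ) (j : ℤ), ∀ a ∈ 𝒜 i, ∀ m ∈ ℳ j, a • m ∈ ℳ ((i : ℤ) + j))
    {c : Ideal A} (hc : c.IsHomogeneous 𝒜) {m : M}
    (hm : m ∈ smulColon (⊥ : Submodule A M) c) (j : ℤ) :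
    (decompose ℳ m j : M) ∈ smulColon (⊥ : Submodule A M) c := by
  classical
  simp only [smulColon, Submodule.mem_iInf, Submodule.mem_comap, Submodule.mem_bot] at hm ⊢
  change ∀ r ∈ c, r • m = 0 at hm
  change ∀ r ∈ c, r • (decompose ℳ m j : M) = 0
  intro r hr
  rw [← sum_support_decompose 𝒜 r, Finset.sum_smul]
  refine Finset.sum_eq_zero fun i _ => ?_
  rw [← decompose_smul_add hsmul (SetLike.coe_mem _), hm _ (hc i hr)]
  simp

theorem decompose_mem_torsionSubmodule [GradedAlgebra 𝒜]
    (hsmul : ∀ (i : ℕ) (j : ℤ), ∀ a ∈ 𝒜 i, ∀ m ∈ ℳ j, a • m ∈ ℳ ((i : ℤ) + j))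
    {a : Ideal A} (ha : a.IsHomogeneous 𝒜) {m : M} (hm : m ∈ torsionSubmodule a M) (j : ℤ) :
    (decompose ℳ m j : M) ∈ torsionSubmodule a M := by
  have hpow (k : ℕ) : (a ^ k).IsHomogeneous 𝒜 := by
    induction k with
    | zero => simpa using Ideal.IsHomogeneous.top 𝒜
    | succ k ih => rw [pow_succ]; exact ih.mul ha
  unfold torsionSubmodule at hm ⊢
  induction hm using Submodule.iSup_induction' with
  | mem k x hx =>
    exact Submodule.mem_iSup_of_mem k (decompose_mem_smulColon_bot hsmul (hpow k) hx j)
  | zero => simp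
  | add x y _ _ hx hy =>
    simp only [decompose_add, DirectSum.add_apply, AddSubgroup.coe_add]
    exact add_mem hx hy

variable (ℳ) in
theorem exists_degree_bounds (T : Finset M) :
    ∃ c d : ℤ, ∀ t ∈ T, ∀ j, (decompose ℳ t j : M) ≠ 0 → c ≤ j ∧ j ≤ d := by
  classical
  let S := T.biUnion fun t => (decompose ℳ t).support
  obtain ⟨c, hc⟩ := S.bddBelow
  obtain ⟨d, hd⟩ := S.bddAbove
  refine ⟨c, d, fun t ht j hj => ?_⟩
  have hjS : j ∈ S := Finset.mem_biUnion.2 ⟨t, ht, by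
    rw [DFinsupp.mem_support_iff]
    exact fun h => hj (by rw [h]; rfl)⟩
  exact ⟨hc hjS, hd hjS⟩

theorem exists_forall_lt_eq_bot [GradedAlgebra 𝒜] [Module.Finite A M]
    (hsmul : ∀ (i : ℕ) (j : ℤ), ∀ a ∈ 𝒜 i, ∀ m ∈ ℳ j, a • m ∈ ℳ ((i : ℤ) + j)) :
    ∃ c : ℤ, ∀ n < c, ℳ n = ⊥ := by
  obtain ⟨T, hT⟩ := Module.Finite.fg_top (R := A) (M := M)
  obtain ⟨c, d, hcd⟩ := exists_degree_bounds ℳ T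
  have key (m : M) : ∀ n < c, (decompose ℳ m n : M) = 0 := by
    have hm : m ∈ Submodule.span A (T : Set M) := hT ▸ Submodule.mem_top
    induction hm using Submodule.span_induction with
    | mem t ht =>
      intro n hn
      by_contra h
      exact absurd (hcd t ht n h).1 (by lia)
    | zero => simp
    | add x y _ _ hx hy =>
      intro n hn
      simp [decompose_add, hx n hn, hy n hn]
    | smul r x _ hx =>
      intro n hn
      induction r using DirectSum.Decomposition.inductionOn 𝒜 with
      | zero => simp
      | @homogeneous i r =>
        have := decompose_smul_add hsmul r.2 x (n - i)
        rwa [add_sub_cancel, hx _ (by lia), smul_zero] at this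
      | add r s hr hs =>
        rw [add_smul, decompose_add, DirectSum.add_apply, AddSubgroup.coe_add, hr, hs, add_zero]
  refine ⟨c, fun n hn => (AddSubgroup.eq_bot_iff_forall _).2 fun m hm => ?_⟩
  rw [← decompose_of_mem_same ℳ hm, key m n hn]

theorem smul_eq_zero_of_forall_smul_eq_zero (hstd : ∀ n, 𝒜 (n + 1) = 𝒜 1 * 𝒜 n)
    {g : M} {e : ℕ} (he : ∀ b ∈ 𝒜 e, b • g = 0) {k : ℕ} (hk : e ≤ k) :
    ∀ b ∈ 𝒜 k, b • g = 0 := by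
  induction k, hk using Nat.le_induction with
  | base => exact he
  | succ k _ ih =>
    intro b hb
    rw [hstd] at hb
    induction hb using Submodule.mul_induction_on' with
    | mem_mul_mem x _ y hy => rw [mul_smul, ih y hy, smul_zero]
    | add x _ y _ hx hy => rw [add_smul, hx, hy, add_zero]

/-- If `R₊` is not contained in the radical of the annihilator of a finitely generated graded
submodule, then all components of large degree of that submodule are nonzero. -/
theorem exists_forall_ne_bot [GradedAlgebra 𝒜]
    (hstd : ∀ n, 𝒜 (n + 1) = 𝒜 1 * 𝒜 n)
    (hsmul : ∀ (i : ℕ) (j : ℤ), ∀ a ∈ 𝒜 i, ∀ m ∈ ℳ j, a • m ∈ ℳ ((i : ℤ) + j))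
    {N : Submodule A M} (hN : N.FG) (hhom : ∀ m ∈ N, ∀ j, (decompose ℳ m j : M) ∈ N)
    (hf : ¬ (HomogeneousIdeal.irrelevant 𝒜).toIdeal ≤ N.annihilator.radical) :
    ∃ n₀ : ℤ, ∀ n ≥ n₀, N.toAddSubgroup ⊓ ℳ n ≠ ⊥ := by
  classical
  obtain ⟨T, hT⟩ := hN
  obtain ⟨c, d, hcd⟩ := exists_degree_bounds ℳ T
  refine ⟨d, fun n hn hbot => hf fun x hx => ?_⟩
  have kill (k : ℕ) (hk : n - c ≤ k) (b : A) (hb : b ∈ 𝒜 k) : b ∈ N.annihilator := by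
    rw [← hT, Submodule.mem_annihilator_span]
    rintro ⟨t, ht⟩
    change b • t = 0
    rw [← sum_support_decompose ℳ t, Finset.smul_sum]
    refine Finset.sum_eq_zero fun j _ => ?_
    by_cases h0 : (decompose ℳ t j : M) = 0
    · rw [h0, smul_zero]
    obtain ⟨hcj, hjd⟩ := hcd t ht j h0
    have hmem : (decompose ℳ t j : M) ∈ N := hhom t (hT ▸ Submodule.subset_span ht) j
    refine smul_eq_zero_of_forall_smul_eq_zero hstd (e := (n - j).toNat) (fun r hr => ?_)
      (by lia) b hb
    have hd := hsmul _ j r hr _ (SetLike.coe_mem (decompose ℳ t j))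
    rw [show ((n - j).toNat : ℤ) + j = n by lia] at hd
    have : r • (decompose ℳ t j : M) ∈ N.toAddSubgroup ⊓ ℳ n := ⟨N.smul_mem r hmem, hd⟩
    rwa [hbot, AddSubgroup.mem_bot] at this
  rw [← sum_support_decompose 𝒜 x]
  refine sum_mem fun i _ => ?_
  rcases Nat.eq_zero_or_pos i with rfl | hi
  · have h0 : (decompose 𝒜 x 0 : A) = 0 := by
      simpa [HomogeneousIdeal.mem_irrelevant_iff] using hx
    rw [h0]
    exact zero_mem _
  · refine ⟨(n - c).toNat, kill ((n - c).toNat * i) ?_ _ ?_⟩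
    · have := Nat.le_mul_of_pos_right (n - c).toNat hi
      lia
    · exact SetLike.pow_mem_graded _ (SetLike.coe_mem (decompose 𝒜 x i))

end GradedAux

/-- Suppose `(R₀, m₀)` is local and `f_a^{R₊}(M) = 0`, i.e. `R₊` is not
contained in `√(0 : Γ_a(M))`. Then `Γ_a(M)ₙ ≠ 0` for all `n ≫ 0`; in particular `Γ_a(M)`
is tame. -/
theorem stmt16 (R₀ A : Type) [CommRing R₀] [IsLocalRing R₀] [CommRing A] [Algebra R₀ A]
    [IsNoetherianRing A]
    (𝒜 : ℕ → Submodule R₀ A) [GradedAlgebra 𝒜]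
    (hstd : ∀ n, 𝒜 (n + 1) = 𝒜 1 * 𝒜 n)
    (M : Type) [AddCommGroup M] [Module A M] [Module.Finite A M]
    (ℳ : ℤ → AddSubgroup M) [DirectSum.Decomposition ℳ]
    (hsmul : ∀ (i : ℕ) (j : ℤ), ∀ a ∈ 𝒜 i, ∀ m ∈ ℳ j, a • m ∈ ℳ ((i : ℤ) + j))
    (a : Ideal A) (ha : a.IsHomogeneous 𝒜)
    (hf : ¬ (HomogeneousIdeal.irrelevant 𝒜).toIdeal
        ≤ (torsionSubmodule a M).annihilator.radical) :
    (∃ n₀ : ℤ, ∀ n ≥ n₀, (torsionSubmodule a M).toAddSubgroup ⊓ ℳ n ≠ ⊥)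
    ∧ {n : ℤ | (torsionSubmodule a M).toAddSubgroup ⊓ ℳ n = ⊥
        ∧ (torsionSubmodule a M).toAddSubgroup ⊓ ℳ (n + 1) ≠ ⊥}.Finite := by
  obtain ⟨n₀, hn₀⟩ := exists_forall_ne_bot hstd hsmul
    (IsNoetherian.noetherian (R := A) (torsionSubmodule a M))
    (fun _ hm j => decompose_mem_torsionSubmodule hsmul ha hm j) hf
  obtain ⟨c, hc⟩ := exists_forall_lt_eq_bot hsmul
  refine ⟨⟨n₀, hn₀⟩, (Set.finite_Icc (c - 1) n₀).subset ?_⟩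
  rintro n ⟨hn, hn'⟩
  constructor
  · by_contra! h
    exact hn' (by rw [hc (n + 1) (by lia), inf_bot_eq])
  · by_contra! h
    exact hn₀ n h.le hn
end

section
/- Let R = ⊕_{n≥0} R_n be a standard graded Noetherian ring, M a finitely generated graded R-module, and a ⊆ b homogeneous ideals. Then f_a^{R_+}(M) ≤ f_b^{R_+}(M). -/
/-- The finiteness invariant
`f_c^{R₊}(M) = sup { k | R₊ ⊆ √(0 : Hⁱ_c(M)) for all i < k }` (valued in `ℕ∞`). -/
noncomputable def fInv {R₀ A : Type} [CommRing R₀] [CommRing A] [Algebra R₀ A]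
    (𝒜 : ℕ → Submodule R₀ A) [GradedAlgebra 𝒜] (c : Ideal A)
    (M : Type) [AddCommGroup M] [Module A M] : ℕ∞ :=
  sSup {k : ℕ∞ | ∀ i : ℕ, (i : ℕ∞) < k → (HomogeneousIdeal.irrelevant 𝒜).toIdeal
    ≤ (Module.annihilator A ((localCohomology c i).obj (ModuleCat.of A M))).radical}

section
open CategoryTheory Limits Opposite

section
variable {D : Type*} [Category* D] [Abelian D] (K : ChainComplex D ℕ) (n : ℕ)

/-- The morphism from homology induced by a morphism on chains that vanishes on boundaries. -/
noncomputable def homologyToOfCocycle {I : D} (f : K.X n ⟶ I) (hf : K.d (n + 1) n ≫ f = 0) :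
    K.homology n ⟶ I :=
  K.homologyι n ≫ K.descOpcycles f (n + 1) (by simp) hf

lemma homologyToOfCocycle_surjective {I : D} [Injective I] (φ : K.homology n ⟶ I) :
    ∃ (f : K.X n ⟶ I) (hf : K.d (n + 1) n ≫ f = 0), homologyToOfCocycle K n f hf = φ := by
  refine ⟨K.pOpcycles n ≫ Injective.factorThru φ (K.homologyι n), by simp, ?_⟩
  rw [homologyToOfCocycle, ← Injective.comp_factorThru φ (K.homologyι n)]
  congr 1
  simp [← cancel_epi (K.pOpcycles n)]

lemma homologyToOfCocycle_eq_zero_iff {I : D} [Injective I] (f : K.X n ⟶ I)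
    (hf : K.d (n + 1) n ≫ f = 0) :
    homologyToOfCocycle K n f hf = 0 ↔
      ∃ g : K.X ((ComplexShape.down ℕ).next n) ⟶ I, K.d _ _ ≫ g = f := by
  constructor
  · intro h
    have hex : (ShortComplex.mk (K.homologyι n) (K.fromOpcycles n
        ((ComplexShape.down ℕ).next n)) (by simp)).Exact :=
      ShortComplex.exact_of_f_is_kernel _ (K.homologyIsKernel n _ rfl)
    refine ⟨hex.descToInjective _ h, ?_⟩
    have := hex.comp_descToInjective _ h
    dsimp at this
    rw [← K.p_fromOpcycles, Category.assoc, this, K.p_descOpcycles]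
  · rintro ⟨g, rfl⟩
    have : K.descOpcycles (K.d n ((ComplexShape.down ℕ).next n) ≫ g) (n + 1) (by simp) hf =
        K.fromOpcycles n _ ≫ g := by
      simp [← cancel_epi (K.pOpcycles n)]
    simp [homologyToOfCocycle, this]

lemma homologyMap_comp_homologyToOfCocycle {K L : ChainComplex D ℕ} (φ : K ⟶ L) {I : D}
    (f : L.X n ⟶ I) (hf : L.d (n + 1) n ≫ f = 0) :
    HomologicalComplex.homologyMap φ n ≫ homologyToOfCocycle L n f hf =
      homologyToOfCocycle K n (φ.f n ≫ f) (by rw [← φ.comm_assoc, hf, comp_zero]) := by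
  have : HomologicalComplex.opcyclesMap φ n ≫ L.descOpcycles f (n + 1) (by simp) hf =
      K.descOpcycles (φ.f n ≫ f) (n + 1) (by simp)
        (by rw [← φ.comm_assoc, hf, comp_zero]) := by
    simp
  rw [homologyToOfCocycle, homologyToOfCocycle, ← this,
    HomologicalComplex.homologyι_naturality_assoc]

lemma homologyToOfCocycle_comp {I J : D} (f : K.X n ⟶ I) (hf : K.d (n + 1) n ≫ f = 0)
    (u : I ⟶ J) :
    homologyToOfCocycle K n (f ≫ u) (by rw [reassoc_of% hf, zero_comp]) =
      homologyToOfCocycle K n f hf ≫ u := by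
  rw [homologyToOfCocycle, homologyToOfCocycle, Category.assoc]
  congr 1
  simp [← cancel_epi (K.pOpcycles n)]

end

section
variable {R : Type} [CommRing R] {N N' : ModuleCat.{0} R} (P : ProjectiveResolution N)
  (Q : ProjectiveResolution N') {M : ModuleCat.{0} R} {n : ℕ}

variable (M) in
/-- The complex `Hom(P, M)`, in the opposite category; its homology computes `Ext R _ n`. -/
noncomputable def homComplex : ChainComplex (ModuleCat.{0} R)ᵒᵖ ℕ :=
  (((linearYoneda R (ModuleCat.{0} R)).obj M).rightOp.mapHomologicalComplex _).obj P.complex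

variable {P Q} (M) in
/-- The map on `homComplex` induced by a map of resolutions. -/
noncomputable def homComplexMap (φ : P.complex ⟶ Q.complex) : homComplex P M ⟶ homComplex Q M :=
  (((linearYoneda R (ModuleCat.{0} R)).obj M).rightOp.mapHomologicalComplex _).map φ

/-- A morphism `P n ⟶ M`, seen as a morphism out of the opposite of the Hom module. -/
noncomputable def homToOp (f : P.complex.X n ⟶ M) :
    (homComplex P M).X n ⟶ op (ModuleCat.of R R) :=
  Quiver.Hom.op (ModuleCat.ofHom (LinearMap.toSpanSingleton R (P.complex.X n ⟶ M) f))

lemma homToOp_surjective (φ : (homComplex P M).X n ⟶ op (ModuleCat.of R R)) :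
    ∃ f : P.complex.X n ⟶ M, homToOp P f = φ := by
  refine ⟨φ.unop.hom (1 : R), ?_⟩
  apply Quiver.Hom.unop_inj
  ext
  exact one_smul R _

lemma homToOp_injective : Function.Injective (homToOp P (M := M) (n := n)) := by
  intro f g h
  have := congr(($h).unop.hom (1 : R))
  exact ((one_smul R f).symm.trans this).trans (one_smul R g)

lemma d_comp_homToOp (m : ℕ) (f : P.complex.X n ⟶ M) :
    (homComplex P M).d m n ≫ homToOp P f = homToOp P (P.complex.d m n ≫ f) := by
  apply Quiver.Hom.unop_inj
  ext
  change P.complex.d m n ≫ ((1 : R) • f) = (1 : R) • (P.complex.d m n ≫ f)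
  simp

lemma homComplexMap_comp_homToOp (φ : P.complex ⟶ Q.complex) (f : Q.complex.X n ⟶ M) :
    (homComplexMap M φ).f n ≫ homToOp Q f = homToOp P (φ.f n ≫ f) := by
  apply Quiver.Hom.unop_inj
  ext
  change φ.f n ≫ ((1 : R) • f) = (1 : R) • (φ.f n ≫ f)
  simp

lemma homToOp_zero : homToOp P (0 : P.complex.X n ⟶ M) = 0 := by
  apply Quiver.Hom.unop_inj
  ext
  exact smul_zero (A := P.complex.X n ⟶ M) (1 : R)

lemma homToOp_smul (r : R) (f : P.complex.X n ⟶ M) :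
    homToOp P (r • f) = homToOp P f ≫ (r • 𝟙 (ModuleCat.of R R)).op := by
  apply Quiver.Hom.unop_inj
  ext
  change (1 : R) • (r • f) = (r • (1 : R)) • f
  simp

lemma d_comp_homToOp_eq_zero {f : P.complex.X n ⟶ M} {m : ℕ} (hf : P.complex.d m n ≫ f = 0) :
    (homComplex P M).d m n ≫ homToOp P f = 0 := by
  rw [d_comp_homToOp, hf, homToOp_zero]

/-- The element of `Ext` given by a generalized element of the homology of `homComplex`. -/
noncomputable def extOfHomology (φ : (homComplex P M).homology n ⟶ op (ModuleCat.of R R)) :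
    ((Ext R (ModuleCat.{0} R) n).obj (op N)).obj M :=
  ((P.isoLeftDerivedObj ((linearYoneda R (ModuleCat.{0} R)).obj M).rightOp n).hom ≫
    φ).unop.hom (1 : R)

lemma extOfHomology_surjective (x : ((Ext R (ModuleCat.{0} R) n).obj (op N)).obj M) :
    ∃ φ, extOfHomology P φ = x := by
  let u : (((linearYoneda R (ModuleCat.{0} R)).obj M).rightOp.leftDerived n).obj N ⟶
      op (ModuleCat.of R R) :=
    Quiver.Hom.op (ModuleCat.ofHom (LinearMap.toSpanSingleton R _ x))
  let e := P.isoLeftDerivedObj ((linearYoneda R (ModuleCat.{0} R)).obj M).rightOp n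
  refine ⟨e.inv ≫ u, ?_⟩
  have h : e.hom ≫ e.inv ≫ u = u := Iso.hom_inv_id_assoc _ _
  exact congr(($h).unop.hom (1 : R)).trans (one_smul R x)

lemma extOfHomology_eq_zero_iff (φ : (homComplex P M).homology n ⟶ op (ModuleCat.of R R)) :
    extOfHomology P φ = 0 ↔ φ = 0 := by
  let e := P.isoLeftDerivedObj ((linearYoneda R (ModuleCat.{0} R)).obj M).rightOp n
  constructor
  · intro h
    have h' : e.hom ≫ φ = 0 := by
      apply Quiver.Hom.unop_inj
      ext
      exact h
    exact (cancel_epi e.hom).1 (h'.trans comp_zero.symm)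
  · rintro rfl
    have h' : e.hom ≫ (0 : (homComplex P M).homology n ⟶ op (ModuleCat.of R R)) = 0 := comp_zero
    exact congr(($h').unop.hom (1 : R))

lemma extOfHomology_smul (r : R) (φ : (homComplex P M).homology n ⟶ op (ModuleCat.of R R)) :
    extOfHomology P (φ ≫ (r • 𝟙 (ModuleCat.of R R)).op) = r • extOfHomology P φ :=
  ((((P.isoLeftDerivedObj ((linearYoneda R (ModuleCat.{0} R)).obj M).rightOp n).hom ≫
    φ).unop.hom).map_smul r (1 : R))

lemma ext_map_extOfHomology (u : N ⟶ N') (φ : P.Hom Q u)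
    (f : (homComplex Q M).homology n ⟶ op (ModuleCat.of R R)) :
    ((Ext R (ModuleCat.{0} R) n).map u.op).app M (extOfHomology Q f) =
      extOfHomology P (HomologicalComplex.homologyMap (homComplexMap M φ.hom) n ≫ f) := by
  have h := ProjectiveResolution.isoLeftDerivedObj_hom_naturality u P Q φ.hom
    (by simpa using φ.hom_f_zero_comp_π_f_zero)
    ((linearYoneda R (ModuleCat.{0} R)).obj M).rightOp n
  have h2 := congr($h ≫ f)
  have h3 := (Category.assoc _ _ _).symm.trans (h2.trans (Category.assoc _ _ _))
  exact congr(($h3).unop.hom (1 : R))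

/-- The class in `Ext` of a cocycle on a projective resolution. -/
noncomputable def extOfCocycle (f : P.complex.X n ⟶ M) (hf : P.complex.d (n + 1) n ≫ f = 0) :
    ((Ext R (ModuleCat.{0} R) n).obj (op N)).obj M :=
  extOfHomology P
    (homologyToOfCocycle (homComplex P M) n (homToOp P f) (d_comp_homToOp_eq_zero P hf))

lemma extOfCocycle_surjective (x : ((Ext R (ModuleCat.{0} R) n).obj (op N)).obj M) :
    ∃ (f : P.complex.X n ⟶ M) (hf : P.complex.d (n + 1) n ≫ f = 0),
      extOfCocycle P f hf = x := by
  obtain ⟨φ, rfl⟩ := extOfHomology_surjective P x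
  obtain ⟨φ, hφ, rfl⟩ := homologyToOfCocycle_surjective (homComplex P M) n φ
  obtain ⟨f, rfl⟩ := homToOp_surjective P φ
  refine ⟨f, homToOp_injective P ?_, rfl⟩
  rw [homToOp_zero, ← d_comp_homToOp, hφ]

lemma extOfCocycle_eq_zero_iff (f : P.complex.X n ⟶ M) (hf : P.complex.d (n + 1) n ≫ f = 0) :
    extOfCocycle P f hf = 0 ↔
      ∃ g : P.complex.X ((ComplexShape.down ℕ).next n) ⟶ M, P.complex.d _ _ ≫ g = f := by
  rw [extOfCocycle, extOfHomology_eq_zero_iff, homologyToOfCocycle_eq_zero_iff]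
  constructor
  · rintro ⟨g, hg⟩
    obtain ⟨g, rfl⟩ := homToOp_surjective P g
    exact ⟨g, homToOp_injective P (by rw [← d_comp_homToOp, hg])⟩
  · rintro ⟨g, rfl⟩
    exact ⟨homToOp P g, d_comp_homToOp P _ _⟩

lemma smul_extOfCocycle (r : R) (f : P.complex.X n ⟶ M)
    (hf : P.complex.d (n + 1) n ≫ f = 0) :
    r • extOfCocycle P f hf = extOfCocycle P (r • f) (by rw [Linear.comp_smul, hf, smul_zero]) := by
  simp only [extOfCocycle, homToOp_smul]
  rw [homologyToOfCocycle_comp _ _ _ (d_comp_homToOp_eq_zero P hf), extOfHomology_smul]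

lemma ext_map_extOfCocycle (u : N ⟶ N') (φ : P.Hom Q u)
    (f : Q.complex.X n ⟶ M) (hf : Q.complex.d (n + 1) n ≫ f = 0) :
    ((Ext R (ModuleCat.{0} R) n).map u.op).app M (extOfCocycle Q f hf) =
      extOfCocycle P (φ.hom.f n ≫ f) (by rw [← φ.hom.comm_assoc, hf, comp_zero]) := by
  simp only [extOfCocycle, ext_map_extOfHomology P Q u φ, homologyMap_comp_homologyToOfCocycle,
    homComplexMap_comp_homToOp]

open CategoryTheory.Abelian CochainComplex.HomComplex in
lemma extMk_eq_zero_iff_exists (f : P.complex.X n ⟶ M) (hf : P.complex.d (n + 1) n ≫ f = 0) :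
    P.extMk f (n + 1) rfl hf = 0 ↔
      ∃ g : P.complex.X ((ComplexShape.down ℕ).next n) ⟶ M, P.complex.d _ _ ≫ g = f := by
  cases n with
  | succ n =>
    rw [P.extMk_eq_zero_iff f _ rfl hf n rfl, ChainComplex.next_nat_succ]
  | zero =>
    have h : (∃ g : P.complex.X ((ComplexShape.down ℕ).next 0) ⟶ M,
        P.complex.d _ _ ≫ g = f) ↔ f = 0 := by
      constructor
      · rintro ⟨g, rfl⟩
        rw [P.complex.shape _ _ (by simp), zero_comp]
      · rintro rfl
        exact ⟨0, by simp⟩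
    rw [h]
    refine ⟨fun h ↦ ?_, by rintro rfl; simp⟩
    rw [← P.extEquivCohomologyClass.apply_eq_iff_eq,
      ProjectiveResolution.extEquivCohomologyClass_extMk,
      ProjectiveResolution.extEquivCohomologyClass_zero,
      CohomologyClass.mk_eq_zero_iff,
      Cocycle.toSingleMk_mem_coboundaries_iff _ _ _ _ _ 1 (by lia)] at h
    obtain ⟨g, hg⟩ := h
    rw [← cancel_epi (P.cochainComplexXIso (-(0 : ℕ)) 0 rfl).hom, ← hg, comp_zero]
    convert zero_comp
    apply IsZero.eq_of_tgt
    exact P.cochainComplex.isZero_of_isStrictlyLE 0 1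
end

section
variable {R : Type} [CommRing R]

/-- The module `R ⧸ c ^ t`. -/
abbrev quotPow (c : Ideal R) (t : ℕ) : ModuleCat.{0} R := ModuleCat.of R (R ⧸ c ^ t)

/-- The projection `R ⧸ c ^ t' ⟶ R ⧸ c ^ t` for `t ≤ t'`. -/
noncomputable def quotPowMap (c : Ideal R) {t t' : ℕ} (h : t ≤ t') : quotPow c t' ⟶ quotPow c t :=
  (localCohomology.ringModIdeals (localCohomology.idealPowersDiagram c)).map (homOfLE h).op

lemma mem_annihilator_iff_of_isColimit {J : Type} [SmallCategory J] [IsFiltered J]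
    (F : J ⥤ ModuleCat.{0} R) {s : Cocone F} (hs : IsColimit s) (r : R) :
    r ∈ Module.annihilator R s.pt ↔
      ∀ j (x : F.obj j), ∃ (j' : J) (f : j ⟶ j'), r • F.map f x = 0 := by
  rw [Module.mem_annihilator]
  constructor
  · intro H j x
    have h0 : s.ι.app j (r • x) = s.ι.app j 0 := by
      rw [map_zero, map_smul]
      exact H _
    obtain ⟨j', f, g, hfg⟩ := Concrete.isColimit_exists_of_rep_eq F hs (r • x) 0 h0
    exact ⟨j', f, by rwa [map_zero, map_smul] at hfg⟩
  · intro H m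
    obtain ⟨j, x, rfl⟩ := Concrete.isColimit_exists_rep F hs m
    obtain ⟨j', f, hx⟩ := H j x
    rw [← s.w f, ModuleCat.comp_apply, ← map_smul]
    exact (congrArg _ hx).trans (map_zero _)

lemma mem_annihilator_localCohomology_iff (c : Ideal R) (i : ℕ) (r : R) (M : ModuleCat.{0} R) :
    r ∈ Module.annihilator R ((localCohomology c i).obj M) ↔
      ∀ t (x : ((Ext R (ModuleCat.{0} R) i).obj (op (quotPow c t))).obj M),
        ∃ (t' : ℕ) (h : t ≤ t'),
          r • ((Ext R (ModuleCat.{0} R) i).map (quotPowMap c h).op).app M x = 0 := by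
  let F := localCohomology.diagram (localCohomology.idealPowersDiagram c) i
  let E : (ModuleCat.{0} R ⥤ ModuleCat.{0} R) ⥤ ModuleCat.{0} R := (evaluation _ _).obj M
  have hc : IsColimit (E.mapCocone (colimit.cocone F)) :=
    isColimitOfPreserves E (colimit.isColimit F)
  refine (mem_annihilator_iff_of_isColimit (F ⋙ E) hc r).trans ⟨fun H t x ↦ ?_, fun H t x ↦ ?_⟩
  · obtain ⟨t', f, hx⟩ := H (op (op t)) x
    exact ⟨t'.unop.unop, leOfHom f.unop.unop, hx⟩
  · obtain ⟨t', h, hx⟩ := H t.unop.unop x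
    exact ⟨op (op t'), (homOfLE h).op.op, hx⟩

open CategoryTheory.Abelian in
/-- Multiplication by `r` is zero on the colimit over `t` of `Ext^i(R ⧸ c ^ t, M)`. -/
def KillsExt (c : Ideal R) (i : ℕ) (r : R) (M : ModuleCat.{0} R) : Prop :=
  ∀ t (x : Abelian.Ext (quotPow c t) M i), ∃ (t' : ℕ) (h : t ≤ t'),
    r • (Ext.mk₀ (quotPowMap c h)).comp x (zero_add i) = 0

/-- A lift of a morphism of modules to projective resolutions. -/
noncomputable def ProjectiveResolution.liftHom {N N' : ModuleCat.{0} R}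
    (P : ProjectiveResolution N) (Q : ProjectiveResolution N') (u : N ⟶ N') : P.Hom Q u where
  hom := ProjectiveResolution.lift u P Q
  hom_f_zero_comp_π_f_zero := by simpa using ProjectiveResolution.lift_commutes_zero u P Q

open CategoryTheory.Abelian in
lemma smul_extMk {N M : ModuleCat.{0} R} (P : ProjectiveResolution N) {n : ℕ} (r : R)
    (f : P.complex.X n ⟶ M) (hf : P.complex.d (n + 1) n ≫ f = 0) :
    r • P.extMk f (n + 1) rfl hf =
      P.extMk (r • f) (n + 1) rfl (by rw [Linear.comp_smul, hf, smul_zero]) := by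
  rw [Ext.smul_eq_comp_mk₀, ProjectiveResolution.extMk_comp_mk₀]
  simp

open CategoryTheory.Abelian in
lemma mem_annihilator_localCohomology_iff_killsExt (c : Ideal R) (i : ℕ) (r : R)
    (M : ModuleCat.{0} R) :
    r ∈ Module.annihilator R ((localCohomology c i).obj M) ↔ KillsExt c i r M := by
  rw [mem_annihilator_localCohomology_iff]
  let P (t : ℕ) : ProjectiveResolution (quotPow c t) := ProjectiveResolution.of _
  let φ {t t' : ℕ} (h : t ≤ t') : (P t').Hom (P t) (quotPowMap c h) :=
    ProjectiveResolution.liftHom _ _ _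
  have key {t t' : ℕ} (h : t ≤ t') (f : (P t).complex.X i ⟶ M)
      (hf : (P t).complex.d (i + 1) i ≫ f = 0) :
      r • ((Ext R (ModuleCat.{0} R) i).map (quotPowMap c h).op).app M
        (extOfCocycle (P t) f hf) = 0 ↔
      r • (Ext.mk₀ (quotPowMap c h)).comp ((P t).extMk f (i + 1) rfl hf) (zero_add i) = 0 := by
    rw [ext_map_extOfCocycle _ _ _ (φ h), smul_extOfCocycle, extOfCocycle_eq_zero_iff,
      ProjectiveResolution.mk₀_comp_extMk _ _ _ _ (φ h), smul_extMk, extMk_eq_zero_iff_exists]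
  constructor
  · intro H t x
    obtain ⟨f, hf, rfl⟩ := (P t).extMk_surjective x (i + 1) rfl
    obtain ⟨t', h, hx⟩ := H t (extOfCocycle (P t) f hf)
    exact ⟨t', h, (key h f hf).1 hx⟩
  · intro H t x
    obtain ⟨f, hf, rfl⟩ := extOfCocycle_surjective (P t) x
    obtain ⟨t', h, hx⟩ := H t ((P t).extMk f (i + 1) rfl hf)
    exact ⟨t', h, (key h f hf).2 hx⟩

lemma quotPowMap_comp (c : Ideal R) {t t' t'' : ℕ} (h : t ≤ t') (h' : t' ≤ t'') :
    quotPowMap c h' ≫ quotPowMap c h = quotPowMap c (h.trans h') :=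
  ((localCohomology.ringModIdeals (localCohomology.idealPowersDiagram c)).map_comp
    (homOfLE h').op (homOfLE h).op).symm

instance (c : Ideal R) {t t' : ℕ} (h : t ≤ t') : Epi (quotPowMap c h) := by
  rw [ModuleCat.epi_iff_surjective]
  intro x
  obtain ⟨x, rfl⟩ := Submodule.Quotient.mk_surjective _ x
  exact ⟨Submodule.Quotient.mk x, rfl⟩

namespace KillsExt
open CategoryTheory.Abelian

variable {c : Ideal R} {i : ℕ} {r s : R} {M : ModuleCat.{0} R}

lemma of_smul_eq_zero (i : ℕ) (h : ∀ m : M, r • m = 0) : KillsExt c i r M := by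
  intro t x
  refine ⟨t, le_rfl, ?_⟩
  have : r • 𝟙 M = 0 := by
    ext m
    exact h m
  rw [Ext.smul_eq_comp_mk₀, this, Ext.mk₀_zero, Ext.comp_zero]

variable {S : ShortComplex (ModuleCat.{0} R)}

lemma X₂ (hS : S.ShortExact) (h₁ : KillsExt c i r S.X₁) (h₃ : KillsExt c i s S.X₃) :
    KillsExt c i (r * s) S.X₂ := by
  intro t x
  obtain ⟨t₁, ht₁, hx⟩ := h₃ t (x.comp (Ext.mk₀ S.g) (add_zero i))
  rw [← Ext.comp_assoc_of_third_deg_zero, ← Ext.smul_comp] at hx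
  obtain ⟨y, hy⟩ := Ext.covariant_sequence_exact₂ _ hS _ hx
  obtain ⟨t₂, ht₂, hy'⟩ := h₁ t₁ y
  refine ⟨t₂, ht₁.trans ht₂, ?_⟩
  rw [← quotPowMap_comp c ht₁ ht₂, ← Ext.mk₀_comp_mk₀, Ext.comp_assoc_of_second_deg_zero,
    mul_smul, ← Ext.comp_smul, ← hy, ← Ext.comp_assoc_of_third_deg_zero, ← Ext.smul_comp, hy',
    Ext.zero_comp]

lemma X₃ (hS : S.ShortExact) (h₂ : KillsExt c i r S.X₂) (h₁ : KillsExt c (i + 1) s S.X₁) :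
    KillsExt c i (r * s) S.X₃ := by
  intro t x
  obtain ⟨t₁, ht₁, hx⟩ := h₁ t (x.comp hS.extClass rfl)
  rw [← Ext.comp_assoc _ _ _ (zero_add i) rfl (by lia), ← Ext.smul_comp] at hx
  obtain ⟨y, hy⟩ := Ext.covariant_sequence_exact₃ _ hS _ _ hx
  obtain ⟨t₂, ht₂, hy'⟩ := h₂ t₁ y
  refine ⟨t₂, ht₁.trans ht₂, ?_⟩
  rw [← quotPowMap_comp c ht₁ ht₂, ← Ext.mk₀_comp_mk₀, Ext.comp_assoc_of_second_deg_zero,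
    mul_smul, ← Ext.comp_smul, ← hy, ← Ext.comp_assoc_of_third_deg_zero, ← Ext.smul_comp, hy',
    Ext.zero_comp]

lemma X₁ (hS : S.ShortExact) (h₃ : KillsExt c i r S.X₃) {t : ℕ}
    (x : Abelian.Ext (quotPow c t) S.X₁ (i + 1)) (hx : x.comp (Ext.mk₀ S.f) (add_zero _) = 0) :
    ∃ (t' : ℕ) (h : t ≤ t'), r • (Ext.mk₀ (quotPowMap c h)).comp x (zero_add _) = 0 := by
  obtain ⟨z, hz⟩ := Ext.covariant_sequence_exact₁ _ hS x hx rfl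
  obtain ⟨t', ht', hz'⟩ := h₃ t z
  refine ⟨t', ht', ?_⟩
  rw [← hz, ← Ext.comp_assoc _ _ _ (zero_add i) rfl (by lia), ← Ext.smul_comp, hz', Ext.zero_comp]

lemma succ_of_isSMulRegular {y : R} (hy : y ∈ c) (hreg : IsSMulRegular M y)
    (h : ∀ t : ℕ, KillsExt c i r (M.smulShortComplex (y ^ t)).X₃) :
    KillsExt c (i + 1) r M := by
  intro t x
  have hS := (hreg.pow t).smulShortComplex_shortExact
  have hx : x.comp (Ext.mk₀ (M.smulShortComplex (y ^ t)).f) (add_zero _) = 0 := by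
    have h0 : y ^ t • 𝟙 (quotPow c t) = 0 := by
      ext
      change y ^ t • (1 : R ⧸ c ^ t) = 0
      rw [Algebra.smul_def, mul_one]
      exact Ideal.Quotient.eq_zero_iff_mem.2 (Ideal.pow_mem_pow hy t)
    have h1 : y ^ t • x = (y ^ t • Ext.mk₀ (𝟙 (quotPow c t))).comp x (zero_add _) := by
      rw [Ext.smul_comp, Ext.mk₀_id_comp]
    refine (Ext.smul_eq_comp_mk₀ x (y ^ t)).symm.trans ?_
    rw [h1, ← Ext.mk₀_smul, h0, Ext.mk₀_zero, Ext.zero_comp]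
    rfl
  exact X₁ hS (h t) x hx

lemma smul_eq_zero_of_pow_smul_eq_zero (h : KillsExt c 0 r M) {t : ℕ} {m : M}
    (hm : ∀ x ∈ c ^ t, x • m = 0) : r • m = 0 := by
  let f : quotPow c t ⟶ M :=
    ModuleCat.ofHom (Submodule.liftQ (c ^ t) (LinearMap.toSpanSingleton R M m) hm)
  obtain ⟨t', ht', hf⟩ := h t (Ext.mk₀ f)
  rw [Ext.mk₀_comp_mk₀, ← Ext.mk₀_smul, Ext.mk₀_eq_zero_iff, ← Linear.comp_smul] at hf
  have hrf : r • f = 0 := (cancel_epi (quotPowMap c ht')).1 (hf.trans comp_zero.symm)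
  have := congr(($hrf).hom (1 : R ⧸ c ^ t))
  change r • ((1 : R) • m) = 0 at this
  rwa [one_smul] at this

lemma zero_of_le {b : Ideal R} (hcb : c ≤ b)
    (h : ∀ (m : M) (t : ℕ), (∀ x ∈ c ^ t, x • m = 0) → r • m = 0) : KillsExt b 0 r M := by
  intro t x
  obtain ⟨f, rfl⟩ := (Ext.mk₀_bijective _ _).2 x
  refine ⟨t, le_rfl, ?_⟩
  have hf : r • f = 0 := by
    ext
    refine h (f.hom (1 : R ⧸ b ^ t)) t fun x hx ↦ ?_
    rw [← map_smul, Algebra.smul_def, mul_one]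
    refine (congrArg f.hom (Ideal.Quotient.eq_zero_iff_mem.2 ?_)).trans (map_zero _)
    exact Ideal.pow_right_mono hcb t hx
  rw [← Ext.comp_smul, ← Ext.mk₀_smul, hf, Ext.mk₀_zero, Ext.comp_zero]

lemma exists_pow_torsion_bound [IsNoetherianRing R] (c : Ideal R) (M : ModuleCat.{0} R)
    [Module.Finite R M] :
    ∃ N, ∀ t (m : M), (∀ x ∈ c ^ t, x • m = 0) → ∀ x ∈ c ^ N, x • m = 0 := by
  let f : ℕ →o Submodule R M :=
    { toFun t := Submodule.torsionBySet R M (c ^ t : Ideal R)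
      monotone' _ _ h := Submodule.torsionBySet_le_torsionBySet_of_subset (Ideal.pow_le_pow_right h) }
  obtain ⟨N, hN⟩ := monotone_stabilizes_iff_noetherian.2 (inferInstance : IsNoetherian R M) f
  refine ⟨N, fun t m hm x hx ↦ ?_⟩
  have hmt : m ∈ f t := (Submodule.mem_torsionBySet_iff _ _).2 fun x ↦ hm x x.2
  have hmN : m ∈ f N := by
    rw [hN _ (le_max_left N t)]
    exact f.monotone (le_max_right N t) hmt
  exact (Submodule.mem_torsionBySet_iff _ _).1 hmN ⟨x, hx⟩

lemma exists_isSMulRegular [IsNoetherianRing R] (c : Ideal R) (M : ModuleCat.{0} R)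
    [Module.Finite R M] (h : ∀ m : M, (∀ x ∈ c, x • m = 0) → m = 0) :
    ∃ y ∈ c, IsSMulRegular M y := by
  have : Subsingleton ((R ⧸ c) →ₗ[R] M) := by
    refine subsingleton_of_forall_eq 0 fun f ↦ ?_
    ext
    refine h _ fun x hx ↦ ?_
    change x • f (1 : R ⧸ c) = 0
    rw [← map_smul, Algebra.smul_def, mul_one]
    exact (congrArg f (Ideal.Quotient.eq_zero_iff_mem.2 hx)).trans (map_zero f)
  obtain ⟨y, hy, hreg⟩ := IsSMulRegular.subsingleton_linearMap_iff.1 this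
  exact ⟨y, by rwa [Ideal.annihilator_quotient] at hy, hreg⟩

/-- If `a ≤ b`, then a uniform power of any `r` killing the `a`-local cohomology of `M` below
degree `k` kills the `b`-local cohomology of `M` below degree `k`. -/
theorem exists_pow_of_le [IsNoetherianRing R] {a b : Ideal R} (hab : a ≤ b) (k : ℕ) :
    ∃ e : ℕ, ∀ (r : R) (M : ModuleCat.{0} R) [Module.Finite R M],
      (∀ i < k, KillsExt a i r M) → ∀ i < k, KillsExt b i (r ^ e) M := by
  induction k with
  | zero => exact ⟨0, fun _ _ _ _ i hi ↦ absurd hi (Nat.not_lt_zero i)⟩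
  | succ k ih =>
    obtain ⟨e, he⟩ := ih
    refine ⟨4 * e + 1, fun r M _ h ↦ ?_⟩
    obtain ⟨N, hN⟩ := exists_pow_torsion_bound a M
    let G : Submodule R M := Submodule.torsionBySet R M (a ^ N : Ideal R)
    have hG (g : G) : r • g = 0 := Subtype.ext <|
      smul_eq_zero_of_pow_smul_eq_zero (h 0 k.succ_pos) (t := N) (m := g.1) fun x hx ↦
        (Submodule.mem_torsionBySet_iff _ _).1 g.2 ⟨x, hx⟩
    let Q : ModuleCat.{0} R := ModuleCat.of R (M ⧸ G)
    have hQ (m : Q) (t : ℕ) (hm : ∀ x ∈ a ^ t, x • m = 0) : m = 0 := by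
      obtain ⟨m, rfl⟩ := Submodule.Quotient.mk_surjective _ m
      refine (Submodule.Quotient.mk_eq_zero _).2 ((Submodule.mem_torsionBySet_iff _ _).2 ?_)
      refine fun x ↦ hN (N + t) m (fun z hz ↦ ?_) x x.2
      rw [pow_add] at hz
      refine Submodule.mul_induction_on hz (fun w hw x hx ↦ ?_) fun x y hx hy ↦ ?_
      · have hxm : x • m ∈ G := (Submodule.Quotient.mk_eq_zero _).1 (hm x hx)
        rw [mul_smul]
        exact (Submodule.mem_torsionBySet_iff _ _).1 hxm ⟨w, hw⟩
      · rw [add_smul, hx, hy, add_zero]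
    let S : ShortComplex (ModuleCat.{0} R) :=
      .mk (ModuleCat.ofHom G.subtype) (ModuleCat.ofHom G.mkQ) (by ext; simp)
    have hS : S.ShortExact :=
      { exact := (ShortComplex.ShortExact.moduleCat_exact_iff_function_exact S).2
          (LinearMap.exact_subtype_mkQ G)
        mono_f := (ModuleCat.mono_iff_injective _).2 G.subtype_injective
        epi_g := (ModuleCat.epi_iff_surjective _).2 G.mkQ_surjective }
    have hQa (i : ℕ) (hi : i < k + 1) : KillsExt a i (r * r) Q :=
      X₃ hS (h i hi) (of_smul_eq_zero (i + 1) hG)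
    have : Module.Finite R Q := inferInstanceAs (Module.Finite R (M ⧸ G))
    obtain ⟨y, hy, hreg⟩ := exists_isSMulRegular a Q fun m hm ↦ hQ m 1 (by rwa [pow_one])
    intro i hi
    have hQb : KillsExt b i ((r * r * (r * r)) ^ e) Q := by
      cases i with
      | zero => exact zero_of_le hab fun m t hm ↦ by rw [hQ m t hm, smul_zero]
      | succ i =>
        refine succ_of_isSMulRegular (hab hy) hreg fun t ↦ ?_
        have : Module.Finite R (Q.smulShortComplex (y ^ t)).X₃ :=
          inferInstanceAs (Module.Finite R (QuotSMulTop (y ^ t) Q))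
        exact he _ _ (fun j hj ↦ X₃ (hreg.pow t).smulShortComplex_shortExact (hQa j (by lia))
          (hQa (j + 1) (by lia))) i (by lia)
    have := X₂ hS (of_smul_eq_zero i hG) hQb
    convert! this using 1
    ring

end KillsExt
end

end

/-- For homogeneous ideals `a ⊆ b`, one has `f_a^{R₊}(M) ≤ f_b^{R₊}(M)`. -/
theorem stmt17 (R₀ A : Type) [CommRing R₀] [CommRing A] [Algebra R₀ A] [IsNoetherianRing A]
    (𝒜 : ℕ → Submodule R₀ A) [GradedAlgebra 𝒜]
    (hstd : ∀ n, 𝒜 (n + 1) = 𝒜 1 * 𝒜 n)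
    (M : Type) [AddCommGroup M] [Module A M] [Module.Finite A M]
    (ℳ : ℤ → AddSubgroup M) [DirectSum.Decomposition ℳ]
    (hsmul : ∀ (i : ℕ) (j : ℤ), ∀ a ∈ 𝒜 i, ∀ m ∈ ℳ j, a • m ∈ ℳ ((i : ℤ) + j))
    (a b : Ideal A) (ha : a.IsHomogeneous 𝒜) (hb : b.IsHomogeneous 𝒜) (hab : a ≤ b) :
    fInv 𝒜 a M ≤ fInv 𝒜 b M := by
  refine sSup_le_sSup fun k hk i hi x hx ↦ ?_
  have hpow (j : ℕ) : ∃ n : ℕ, j < i + 1 →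
      x ^ n ∈ Module.annihilator A ((localCohomology a j).obj (ModuleCat.of A M)) := by
    by_cases hj : j < i + 1
    · obtain ⟨n, hn⟩ := hk j (lt_of_le_of_lt (Nat.cast_le.2 (by lia)) hi) hx
      exact ⟨n, fun _ ↦ hn⟩
    · exact ⟨0, fun h ↦ absurd h hj⟩
  choose n hn using hpow
  obtain ⟨e, he⟩ := KillsExt.exists_pow_of_le hab (i + 1)
  have h := he (x ^ ∑ j ∈ Finset.range (i + 1), n j) (ModuleCat.of A M) (fun j hj ↦
    (mem_annihilator_localCohomology_iff_killsExt _ _ _ _).1 (Ideal.mem_of_dvd _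
      (pow_dvd_pow x (Finset.single_le_sum (fun _ _ ↦ Nat.zero_le _) (Finset.mem_range.2 hj)))
      (hn j hj))) i i.lt_succ_self
  rw [← mem_annihilator_localCohomology_iff_killsExt, ← pow_mul] at h
  exact ⟨_, h⟩
end

section
/- Let R = ⊕_{n≥0} R_n be a standard graded Noetherian ring, M a finitely generated graded R-module, and I an ideal generated by a maximal M-regular sequence in R_+ with t := grade(I, M) = grade(R_+, M). If Supp(M/IM) ⊆ V(R_+), then M is relative Cohen-Macaulay with respect to R_+ of degree t, i.e., H^i_{R_+}(M) = 0 for all i ≠ t. -/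
open RingTheory.Sequence

/-- `grade(c, M)`: the common length of maximal `M`-regular sequences inside `c`. -/
noncomputable def mgrade {A : Type} [CommRing A] (c : Ideal A) (M : Type) [AddCommGroup M]
    [Module A M] : ℕ :=
  sSup {n : ℕ | ∃ rs : List A, rs.length = n ∧ (∀ r ∈ rs, r ∈ c) ∧ IsRegular M rs}

section

open CategoryTheory CategoryTheory.Limits

universe w v u

section

variable {C : Type u} [Category.{v} C] [Abelian C] [HasExt.{w} C]

lemma CategoryTheory.ProjectiveResolution.eq_zero_of_extMk_eq_zero {X Y : C}
    (P : ProjectiveResolution X) (f : P.complex.X 0 ⟶ Y) (hf : P.complex.d 1 0 ≫ f = 0)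
    (h : P.extMk f 1 rfl hf = 0) : f = 0 := by
  simp only [← P.extEquivCohomologyClass.apply_eq_iff_eq,
    ProjectiveResolution.extEquivCohomologyClass_extMk,
    ProjectiveResolution.extEquivCohomologyClass_zero,
    CochainComplex.HomComplex.CohomologyClass.mk_eq_zero_iff] at h
  rw [CochainComplex.HomComplex.Cocycle.toSingleMk_mem_coboundaries_iff _ _ _ _ _ 1 (by simp)] at h
  obtain ⟨g, hg⟩ := h
  have hz : g = 0 := by
    apply IsZero.eq_of_src
    exact CochainComplex.isZero_of_isStrictlyLE _ 0 1 (by simp)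
  rw [hz, comp_zero] at hg
  rw [← cancel_epi (P.cochainComplexXIso (-(0 : ℕ)) 0 rfl).hom, ← hg, comp_zero]

end

section

variable {R : Type v} [Ring R] {C : Type u} [Category.{v} C] [Abelian C] [Linear R C]
  [EnoughProjectives C] [HasExt.{v} C]

/-- If precomposition with `g` is zero on `Ext`-groups in the derived category, it is zero on the
`Ext`-modules defined by projective resolutions. -/
lemma ext_map_app_eq_zero {X' X : C} (g : X' ⟶ X) (Y : C) (n : ℕ)
    (h : ∀ α : Abelian.Ext X Y n, (Abelian.Ext.mk₀ g).comp α (zero_add n) = 0) :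
    ((Ext R C n).map g.op).app Y = 0 := by
  let P := projectiveResolution X
  let P' := projectiveResolution X'
  let φ : ProjectiveResolution.Hom P' P g := ⟨ProjectiveResolution.lift g P' P, by
    simpa using ProjectiveResolution.lift_commutes_zero g P' P⟩
  have hbdry (f : P.complex.X n ⟶ Y) (hf : P.complex.d (n + 1) n ≫ f = 0) :
      ∃ p, ∃ k : P'.complex.X p ⟶ Y, φ.hom.f n ≫ f = P'.complex.d n p ≫ k := by
    have h0 := h (P.extMk f _ rfl hf)
    rw [ProjectiveResolution.mk₀_comp_extMk f _ rfl hf φ] at h0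
    cases n with
    | zero => exact ⟨0, 0, by simpa using P'.eq_zero_of_extMk_eq_zero _ _ h0⟩
    | succ n =>
      obtain ⟨k, hk⟩ := (P'.extMk_eq_zero_iff _ _ _ _ n rfl).1 h0
      exact ⟨n, k, hk.symm⟩
  let F := ((linearYoneda R C).obj Y).rightOp
  change ((F.leftDerived n).map g).unop = 0
  rw [Functor.leftDerived_map_eq F n g (P := P') (Q := P) φ.hom
    (by simp [φ])]
  suffices hz : (F.mapHomologicalComplex _ ⋙
      HomologicalComplex.homologyFunctor _ (ComplexShape.down ℕ) n).map φ.hom = 0 by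
    rw [hz, zero_comp, comp_zero, unop_zero]
  change HomologicalComplex.homologyMap ((F.mapHomologicalComplex _).map φ.hom) n = 0
  rw [← cancel_epi (HomologicalComplex.homologyπ _ _),
    ← cancel_mono (HomologicalComplex.homologyι _ _)]
  simp only [comp_zero, zero_comp, HomologicalComplex.homologyι_naturality, Category.assoc,
    HomologicalComplex.homology_π_ι_assoc, HomologicalComplex.p_opcyclesMap]
  apply Quiver.Hom.unop_inj
  ext z
  have hf := ConcreteCategory.congr_hom (congrArg Quiver.Hom.unop (HomologicalComplex.d_pOpcycles
    ((F.mapHomologicalComplex (ComplexShape.down ℕ)).obj P.complex) (n + 1) n)) z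
  obtain ⟨p, k, hk⟩ := hbdry _ hf
  have hk' := ConcreteCategory.congr_hom (congrArg Quiver.Hom.unop (HomologicalComplex.iCycles_d
    ((F.mapHomologicalComplex (ComplexShape.down ℕ)).obj P'.complex) n p)) k
  refine Eq.trans (congrArg (ConcreteCategory.hom (HomologicalComplex.iCycles
    ((F.mapHomologicalComplex (ComplexShape.down ℕ)).obj P'.complex) n).unop) hk) hk'

end

section

open Abelian

variable {A : Type u} [CommRing A]

lemma ModuleCat.smul_ext_eq_zero {N M : ModuleCat.{u} A} {x : A} (hx : x ∈ Module.annihilator A N)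
    {i : ℕ} (α : Ext N M i) : x • α = 0 := by
  have h : x • 𝟙 N = 0 := by
    ext y
    exact Module.mem_annihilator.1 hx y
  rw [← Ext.mk₀_id_comp α, ← Ext.smul_comp, ← Ext.mk₀_smul, h, Ext.mk₀_zero, Ext.zero_comp]

/-- If the left-hand map of a morphism of short exact sequences annihilates `Ext^i(-, M)`, then its
right-hand map annihilates `Ext^(i+1)(-, M)`, provided the target has projective middle term. -/
lemma CategoryTheory.ShortComplex.ShortExact.precomp_τ₃_eq_zero
    {S₁ S₂ : ShortComplex (ModuleCat.{u} A)} (h₁ : S₁.ShortExact) (h₂ : S₂.ShortExact)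
    [Projective S₂.X₂] (f : S₁ ⟶ S₂) (M : ModuleCat.{u} A) (i : ℕ)
    (hf : ∀ α : Ext S₂.X₁ M i, (Ext.mk₀ f.τ₁).comp α (zero_add i) = 0)
    (α : Ext S₂.X₃ M (i + 1)) : (Ext.mk₀ f.τ₃).comp α (zero_add (i + 1)) = 0 := by
  obtain ⟨β, rfl⟩ := Ext.contravariant_sequence_exact₃ h₂ M α (Ext.eq_zero_of_projective _)
    (add_comm 1 i)
  rw [← Ext.comp_assoc _ _ _ (zero_add 1) (add_comm 1 i) (by lia),
    ← ShortComplex.ShortExact.extClass_naturality h₁ h₂ f,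
    Ext.comp_assoc _ _ _ (add_zero 1) (zero_add i) (by lia), hf, Ext.comp_zero]

lemma ModuleCat.precomp_eq_zero_of_range_le {N N' : Type u} [AddCommGroup N]
    [Module A N] [AddCommGroup N'] [Module A N'] (L : Submodule A N) (M : ModuleCat.{u} A) (i : ℕ)
    (hL : ∀ α : Ext (ModuleCat.of A N) M i,
      (Ext.mk₀ (ModuleCat.ofHom L.subtype)).comp α (zero_add i) = 0)
    (g : N' →ₗ[A] N) (hg : ∀ y, g y ∈ L) (α : Ext (ModuleCat.of A N) M i) :
    (Ext.mk₀ (ModuleCat.ofHom g)).comp α (zero_add i) = 0 := by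
  have : ModuleCat.ofHom g =
      ModuleCat.ofHom (g.codRestrict L hg) ≫ ModuleCat.ofHom L.subtype := by
    rw [← ModuleCat.ofHom_comp, LinearMap.subtype_comp_codRestrict]
  rw [this, ← Ext.mk₀_comp_mk₀, Ext.comp_assoc _ _ _ (zero_add 0) (zero_add i) (by lia), hL,
    Ext.comp_zero]

lemma Ideal.exists_precomp_pow_smul_top_eq_zero_succ [IsNoetherianRing A] (J : Ideal A)
    (M : ModuleCat.{u} A) (i : ℕ) {N F : Type u} [AddCommGroup N] [Module A N] [AddCommGroup F]
    [Module A F] [Module.Finite A F] [Module.Projective A F] (f : F →ₗ[A] N)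
    (hf : Function.Surjective f) {m₀ : ℕ}
    (hm₀ : ∀ α : Ext (ModuleCat.of A (LinearMap.ker f)) M i,
      (Ext.mk₀ (ModuleCat.ofHom (J ^ m₀ • ⊤ : Submodule A (LinearMap.ker f)).subtype)).comp α
        (zero_add i) = 0) :
    ∃ m, ∀ α : Ext (ModuleCat.of A N) M (i + 1),
      (Ext.mk₀ (ModuleCat.ofHom (J ^ m • ⊤ : Submodule A N).subtype)).comp α
        (zero_add (i + 1)) = 0 := by
  obtain ⟨c, hc⟩ := J.exists_pow_inf_eq_pow_smul (LinearMap.ker f)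
  refine ⟨m₀ + c, ?_⟩
  have hmap : (J ^ (m₀ + c) • ⊤ : Submodule A F).map f = J ^ (m₀ + c) • ⊤ := by
    rw [Submodule.map_smul'', Submodule.map_top, LinearMap.range_eq_top.2 hf]
  obtain ⟨L, hL⟩ : ∃ L : Submodule A F, L = J ^ (m₀ + c) • ⊤ := ⟨_, rfl⟩
  rw [← hL] at hmap
  rw [← hmap]
  let f' : L →ₗ[A] L.map f := f.submoduleMap L
  have hf' : Function.Surjective f' := f.submoduleMap_surjective L
  have : Projective f.shortComplexKer.X₂ := by
    dsimp
    infer_instance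
  have hker (x : LinearMap.ker f') : (x : F) ∈ LinearMap.ker f :=
    congrArg Subtype.val (LinearMap.mem_ker.1 x.2)
  let g : LinearMap.ker f' →ₗ[A] LinearMap.ker f :=
    (L.subtype ∘ₗ (LinearMap.ker f').subtype).codRestrict _ hker
  refine ShortComplex.ShortExact.precomp_τ₃_eq_zero
    (LinearMap.shortExact_shortComplexKer hf') (LinearMap.shortExact_shortComplexKer hf)
    { τ₁ := ModuleCat.ofHom g
      τ₂ := ModuleCat.ofHom L.subtype
      τ₃ := ModuleCat.ofHom (L.map f).subtype
      comm₁₂ := rfl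
      comm₂₃ := rfl } M i ?_
  refine ModuleCat.precomp_eq_zero_of_range_le _ M i hm₀ g fun y ↦ ?_
  have hy : (y : F) ∈ J ^ (m₀ + c) • ⊤ ⊓ LinearMap.ker f := ⟨hL ▸ y.1.2, hker y⟩
  rw [hc _ le_add_self, Nat.add_sub_cancel] at hy
  have hy' := Submodule.smul_mono (le_refl (J ^ m₀)) inf_le_right hy
  have he : J ^ m₀ • LinearMap.ker f =
      (J ^ m₀ • ⊤ : Submodule A (LinearMap.ker f)).map (LinearMap.ker f).subtype := by
    rw [Submodule.map_smul'', Submodule.map_top, Submodule.range_subtype]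
  rw [he] at hy'
  obtain ⟨z, hz, hzy⟩ := hy'
  rwa [show g y = z from Subtype.ext hzy.symm]

/-- If a power of `J` annihilates `M`, then for large `m` the inclusion `J ^ m • N ⟶ N` induces the
zero map on `Ext^i(-, M)`. -/
lemma Ideal.exists_precomp_pow_smul_top_eq_zero [IsNoetherianRing A] (J : Ideal A)
    (M : ModuleCat.{u} A) {k : ℕ} (hk : J ^ k ≤ Module.annihilator A M) (i : ℕ)
    (N : Type u) [AddCommGroup N] [Module A N] [Module.Finite A N] :
    ∃ m, ∀ α : Ext (ModuleCat.of A N) M i,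
      (Ext.mk₀ (ModuleCat.ofHom (J ^ m • ⊤ : Submodule A N).subtype)).comp α (zero_add i) = 0 := by
  induction i generalizing N with
  | zero =>
    refine ⟨k, fun α ↦ ?_⟩
    obtain ⟨f, rfl⟩ := Ext.addEquiv₀.symm.surjective α
    have hzero : ModuleCat.ofHom (J ^ k • ⊤ : Submodule A N).subtype ≫ f = 0 := by
      ext ⟨y, hy⟩
      suffices h : (J ^ k • ⊤ : Submodule A N) ≤ LinearMap.ker f.hom from h hy
      refine Submodule.smul_le.2 fun r hr n _ ↦ ?_
      rw [LinearMap.mem_ker, map_smul]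
      exact Module.mem_annihilator.1 (hk hr) _
    rw [Ext.addEquiv₀_symm_apply, Ext.mk₀_comp_mk₀, hzero, Ext.mk₀_zero]
  | succ i ih =>
    obtain ⟨r, f, hf⟩ := Module.Finite.exists_fin' A N
    obtain ⟨m₀, hm₀⟩ := ih (LinearMap.ker f)
    exact J.exists_precomp_pow_smul_top_eq_zero_succ M i f hf hm₀

/-- The projection `A ⧸ I ⟶ A ⧸ K` for `I ≤ K`. -/
abbrev Ideal.quotientProj {I K : Ideal A} (h : I ≤ K) :
    ModuleCat.of A (A ⧸ I) ⟶ ModuleCat.of A (A ⧸ K) :=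
  ModuleCat.ofHom (Submodule.mapQ I K LinearMap.id h)

/-- The inductive system `Ext^i(A ⧸ J ^ n, M)` is essentially zero. -/
def Ideal.IsEssentiallyZeroExt (J : Ideal A) (M : ModuleCat.{u} A) (i : ℕ) : Prop :=
  ∀ n, ∃ m, ∃ h : n ≤ m, ∀ α : Ext (ModuleCat.of A (A ⧸ J ^ n)) M i,
    (Ext.mk₀ (Ideal.quotientProj (Ideal.pow_le_pow_right h : J ^ m ≤ J ^ n))).comp α
      (zero_add i) = 0

lemma Ideal.isEssentiallyZeroExt_of_pow_le_annihilator [IsNoetherianRing A] {J : Ideal A}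
    {M : ModuleCat.{u} A} {k : ℕ} (hk : J ^ k ≤ Module.annihilator A M) (i : ℕ) :
    J.IsEssentiallyZeroExt M (i + 1) := by
  intro n
  have hex (K : Ideal A) : (K.mkQ.shortComplexKer).ShortExact :=
    LinearMap.shortExact_shortComplexKer K.mkQ_surjective
  obtain ⟨m, hm⟩ := J.exists_precomp_pow_smul_top_eq_zero M hk i (LinearMap.ker (J ^ n).mkQ)
  have hle : J ^ (m + n) ≤ J ^ n := Ideal.pow_le_pow_right le_add_self
  refine ⟨m + n, le_add_self, ?_⟩
  have : Projective (J ^ n).mkQ.shortComplexKer.X₂ := by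
    dsimp
    infer_instance
  have hker : LinearMap.ker (J ^ (m + n)).mkQ ≤ LinearMap.ker (J ^ n).mkQ := by
    simpa only [Submodule.ker_mkQ] using hle
  refine ShortComplex.ShortExact.precomp_τ₃_eq_zero (hex (J ^ (m + n))) (hex (J ^ n))
    { τ₁ := ModuleCat.ofHom (Submodule.inclusion hker)
      τ₂ := 𝟙 _
      τ₃ := Ideal.quotientProj hle
      comm₁₂ := rfl
      comm₂₃ := rfl } M i ?_
  refine ModuleCat.precomp_eq_zero_of_range_le _ M i hm _ fun y ↦ ?_
  have he : J ^ (m + n) =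
      (J ^ m • ⊤ : Submodule A (LinearMap.ker (J ^ n).mkQ)).map
        (LinearMap.ker (J ^ n).mkQ).subtype := by
    rw [Submodule.map_smul'', Submodule.map_top, Submodule.range_subtype, Submodule.ker_mkQ,
      pow_add, smul_eq_mul]
  have hy : (y : A) ∈ J ^ (m + n) := by simpa only [Submodule.ker_mkQ] using y.2
  obtain ⟨z, hz, hzy⟩ := he.le hy
  rwa [show Submodule.inclusion hker y = z from Subtype.ext hzy.symm]

lemma ModuleCat.precomp_eq_zero_of_smul_eq_zero {M N N' : ModuleCat.{u} A} {x : A}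
    (hreg : IsSMulRegular M x) {i : ℕ} (g : N' ⟶ N)
    (hg : ∀ β : Ext N (ModuleCat.of A (QuotSMulTop x M)) i, (Ext.mk₀ g).comp β (zero_add i) = 0)
    (γ : Ext N M (i + 1)) (hγ : x • γ = 0) : (Ext.mk₀ g).comp γ (zero_add (i + 1)) = 0 := by
  have hS := hreg.smulShortComplex_shortExact
  obtain ⟨β, hβ⟩ : ∃ β : Ext N (M.smulShortComplex x).X₃ i, β.comp hS.extClass rfl = γ :=
    Ext.covariant_sequence_exact₁ N hS γ ((Ext.smul_eq_comp_mk₀ γ x).symm.trans hγ) rfl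
  subst hβ
  have h₀ : (Ext.mk₀ g).comp β (zero_add i) = 0 := hg β
  refine (Ext.comp_assoc (Ext.mk₀ g) β hS.extClass (zero_add i) rfl (by lia)).symm.trans ?_
  rw [h₀]
  exact Ext.zero_comp N' i hS.extClass (i + 1) rfl

lemma Ideal.IsEssentiallyZeroExt.of_quotSMulTop {J : Ideal A} {M : ModuleCat.{u} A} {x : A}
    (hx : x ∈ J) (hreg : IsSMulRegular M x) {i : ℕ}
    (h : J.IsEssentiallyZeroExt (ModuleCat.of A (QuotSMulTop x M)) i) :
    J.IsEssentiallyZeroExt M (i + 1) := by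
  have hcomp {a b c : ℕ} (hab : a ≤ b) (hbc : b ≤ c)
      (α : Ext (ModuleCat.of A (A ⧸ J ^ a)) M (i + 1)) :
      (Ext.mk₀ (Ideal.quotientProj (Ideal.pow_le_pow_right (hab.trans hbc) : J ^ c ≤ J ^ a))).comp
        α (zero_add _) = (Ext.mk₀ (Ideal.quotientProj
          (Ideal.pow_le_pow_right hbc : J ^ c ≤ J ^ b))).comp ((Ext.mk₀ (Ideal.quotientProj
          (Ideal.pow_le_pow_right hab : J ^ b ≤ J ^ a))).comp α (zero_add _)) (zero_add _) := by
    rw [← Ext.comp_assoc _ _ _ (zero_add 0) (zero_add _) (by lia), Ext.mk₀_comp_mk₀]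
    congr 2
    ext
    rfl
  have key (k : ℕ) : ∀ n, ∃ m, ∃ h : n ≤ m, ∀ α : Ext (ModuleCat.of A (A ⧸ J ^ n)) M (i + 1),
      x ^ k • α = 0 → (Ext.mk₀ (Ideal.quotientProj
        (Ideal.pow_le_pow_right h : J ^ m ≤ J ^ n))).comp α (zero_add _) = 0 := by
    induction k with
    | zero => exact fun n ↦ ⟨n, le_rfl, fun α hα ↦ by simp_all⟩
    | succ k ih =>
      intro n
      obtain ⟨m₁, hm₁, h₁⟩ := h n
      obtain ⟨m, hm, h₂⟩ := ih m₁
      refine ⟨m, hm₁.trans hm, fun α hα ↦ ?_⟩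
      rw [hcomp hm₁ hm]
      refine h₂ _ ?_
      rw [← Ext.comp_smul]
      refine ModuleCat.precomp_eq_zero_of_smul_eq_zero hreg _ h₁ _ ?_
      rw [smul_smul, ← pow_succ', hα]
  intro n
  obtain ⟨m, hm, h'⟩ := key n n
  refine ⟨m, hm, fun α ↦ h' α (ModuleCat.smul_ext_eq_zero ?_ α)⟩
  change x ^ n ∈ Module.annihilator A (A ⧸ J ^ n)
  rw [Ideal.annihilator_quotient]
  exact Ideal.pow_mem_pow hx n

lemma Ideal.isEssentiallyZeroExt_of_lt [IsNoetherianRing A] {J : Ideal A} (rs : List A)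
    (hmem : ∀ r ∈ rs, r ∈ J) (M : ModuleCat.{u} A) (hreg : IsWeaklyRegular M rs)
    (hJ : J ≤ (Module.annihilator A (M ⧸ (Ideal.ofList rs • ⊤ : Submodule A M))).radical)
    (i : ℕ) (hi : rs.length < i) : J.IsEssentiallyZeroExt M i := by
  induction rs generalizing M i with
  | nil =>
    obtain ⟨i, rfl⟩ := Nat.exists_eq_succ_of_ne_zero hi.ne'
    obtain ⟨k, hk⟩ := Ideal.exists_pow_le_of_le_radical_of_fg hJ (IsNoetherian.noetherian J)
    have h₀ : (Ideal.ofList [] • ⊤ : Submodule A M) = ⊥ :=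
      (congrArg (· • ⊤) Ideal.ofList_nil).trans (Submodule.bot_smul ⊤)
    rw [(Submodule.quotEquivOfEqBot _ h₀).annihilator_eq] at hk
    exact Ideal.isEssentiallyZeroExt_of_pow_le_annihilator hk i
  | cons x rs ih =>
    obtain ⟨i, rfl⟩ := Nat.exists_eq_succ_of_ne_zero (Nat.ne_zero_of_lt hi)
    rw [isWeaklyRegular_cons_iff] at hreg
    rw [(Submodule.quotOfListConsSMulTopEquivQuotSMulTopInner M x rs).annihilator_eq] at hJ
    have hmem' : ∀ r ∈ rs, r ∈ J := fun r hr ↦ hmem r (List.mem_cons_of_mem x hr)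
    exact Ideal.IsEssentiallyZeroExt.of_quotSMulTop (hmem x List.mem_cons_self) hreg.1
      (ih hmem' (ModuleCat.of A (QuotSMulTop x M)) hreg.2 hJ i (Nat.lt_of_succ_lt_succ hi))

lemma Ideal.isEssentiallyZeroExt_of_lt_length [IsNoetherianRing A] {J : Ideal A} (rs : List A)
    (hmem : ∀ r ∈ rs, r ∈ J) (M : ModuleCat.{u} A) [Module.Finite A M] (hreg : IsRegular M rs)
    (i : ℕ) (hi : i < rs.length) : J.IsEssentiallyZeroExt M i := by
  refine fun n ↦ ⟨n, le_rfl, fun α ↦ ?_⟩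
  have hle : Ideal.ofList rs ≤ J := Ideal.span_le.2 hmem
  have : Subsingleton (Ext (ModuleCat.of A (A ⧸ J ^ n)) M i) := by
    refine ModuleCat.subsingleton_ext_of_exists_isRegular (Ideal.ofList rs) _ ?_ M
      (lt_top_iff_ne_top.2 hreg.2.symm) rs (fun r hr ↦ Ideal.subset_span hr) hreg i hi
    change Module.support A (A ⧸ J ^ n) ⊆ _
    rw [Module.support_eq_zeroLocus, Ideal.annihilator_quotient]
    intro p hp
    exact hle.trans (p.2.le_of_pow_le hp)
  rw [Subsingleton.elim α 0, Ext.comp_zero]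

lemma Ideal.le_radical_annihilator_of_support_subset {J : Ideal A}
    {N : Type*} [AddCommGroup N] [Module A N] [Module.Finite A N]
    (h : Module.support A N ⊆ {p | J ≤ p.asIdeal}) : J ≤ (Module.annihilator A N).radical := by
  rw [Ideal.radical_eq_sInf]
  refine le_sInf fun p hp ↦ ?_
  rw [Module.support_eq_zeroLocus] at h
  exact @h ⟨p, hp.2⟩ hp.1

/-- Local cohomology vanishes if the system of `Ext`-groups defining it is essentially zero. -/
lemma subsingleton_localCohomology_obj {J : Ideal A} {i : ℕ}
    {M : ModuleCat.{u} A} (h : J.IsEssentiallyZeroExt M i) :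
    Subsingleton ((localCohomology J i).obj M) := by
  let D := localCohomology.diagram (localCohomology.idealPowersDiagram J) i
  have := localCohomology.hasColimitDiagram (localCohomology.idealPowersDiagram J) i
  apply ModuleCat.subsingleton_of_isZero
  change IsZero ((colimit D).obj M)
  rw [IsZero.iff_id_eq_zero]
  refine (isColimitOfPreserves ((evaluation _ _).obj M) (colimit.isColimit D)).hom_ext
    fun ⟨⟨n⟩⟩ ↦ ?_
  obtain ⟨m, hnm, hm⟩ := h n
  let f : Opposite.op m ⟶ Opposite.op n := (homOfLE hnm).op
  have hf : (D.map f.op).app M = 0 := ext_map_app_eq_zero _ M i hm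
  change (colimit.ι D (.op (.op n))).app M ≫ _ = (colimit.ι D (.op (.op n))).app M ≫ _
  rw [← colimit.w D f.op, NatTrans.comp_app, hf]
  simp only [zero_comp]

end

end

/-- If `I` is generated by a maximal `M`-regular sequence in `R₊` with
`t := grade(I,M) = grade(R₊,M)` and `Supp(M/IM) ⊆ V(R₊)`, then `M` is relative
Cohen–Macaulay with respect to `R₊` of degree `t`: `Hⁱ_{R₊}(M) = 0` for all `i ≠ t`. -/
theorem stmt19 (R₀ A : Type) [CommRing R₀] [CommRing A] [Algebra R₀ A] [IsNoetherianRing A]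
    (𝒜 : ℕ → Submodule R₀ A) [GradedAlgebra 𝒜]
    (hstd : ∀ n, 𝒜 (n + 1) = 𝒜 1 * 𝒜 n)
    (M : Type) [AddCommGroup M] [Module A M] [Module.Finite A M]
    (ℳ : ℤ → AddSubgroup M) [DirectSum.Decomposition ℳ]
    (hsmul : ∀ (i : ℕ) (j : ℤ), ∀ a ∈ 𝒜 i, ∀ m ∈ ℳ j, a • m ∈ ℳ ((i : ℤ) + j))
    (rs : List A) (hmem : ∀ r ∈ rs, r ∈ (HomogeneousIdeal.irrelevant 𝒜).toIdeal)
    (hreg : IsRegular M rs) (t : ℕ) (hlen : rs.length = t)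
    (htI : mgrade (Ideal.ofList rs) M = t)
    (htR : mgrade (HomogeneousIdeal.irrelevant 𝒜).toIdeal M = t)
    (hsupp : Module.support A (M ⧸ (Ideal.ofList rs • ⊤ : Submodule A M))
      ⊆ {p : PrimeSpectrum A | (HomogeneousIdeal.irrelevant 𝒜).toIdeal ≤ p.asIdeal}) :
    ∀ i : ℕ, i ≠ t →
      Subsingleton ((localCohomology (HomogeneousIdeal.irrelevant 𝒜).toIdeal i).obj
        (ModuleCat.of A M)) := by
  intro i hi
  apply subsingleton_localCohomology_obj
  subst hlen
  rcases lt_or_gt_of_ne hi with hi | hi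
  · exact Ideal.isEssentiallyZeroExt_of_lt_length rs hmem (ModuleCat.of A M) hreg i hi
  · exact Ideal.isEssentiallyZeroExt_of_lt rs hmem (ModuleCat.of A M) hreg.toIsWeaklyRegular
      (Ideal.le_radical_annihilator_of_support_subset hsupp) i hi
end
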